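/- arXiv:q-alg/9505013 — 2 statements merged into one kernel-verified Lean document; each statement's English description precedes it below -/
import Mathlib

section
/- Let 0 < q < 1, r ≥ 1, and Re z > 0. Then G_r(z+1;q) = lim_{N→∞} ( G_{r-1}(1;q)⋯G_{r-1}(N;q) / (G_{r-1}(z+1;q)⋯G_{r-1}(z+N;q)) ) · ∏_{m=1}^{r} G_{r-m}(N+1;q)^{C(z,m)}, a q-analogue of Gauss's product formula for the multiple gamma function. -/
open Finset Filter Topology

/-- Generalized binomial coefficient C(z,k) = z(z-1)⋯(z-k+1)/k!. -/
noncomputable def genBinom (z : ℂ) (k : ℕ) : ℂ :=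
  (∏ i ∈ Finset.range k, (z - i)) / (Nat.factorial k)

/-- g_r(z,n) = ∑_{m=1}^{r-1} (-1)^{m-1} C(z, r-m) C(n+m-2, m-1), with g_1 = 0. -/
noncomputable def qg (r : ℕ) (z : ℂ) (n : ℕ) : ℂ :=
  ∑ m ∈ Finset.Icc 1 (r - 1),
    (-1 : ℂ) ^ (m - 1) * genBinom z (r - m) * (Nat.choose (n + m - 2) (m - 1))

/-- The q-analogue of the multiple gamma function: `qMG q r z = G_r(z; q)`.
For `r = 0` it is the q-number `[z] = (1-q^z)/(1-q)`; for `r ≥ 1`,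
`G_r(z+1;q) = (1-q)^{-C(z,r)} ∏_{n≥1} ((1-q^{z+n})/(1-q^n))^{(-1)^r C(n+r-2,r-1)} (1-q^n)^{g_r(z,n)}`. -/
noncomputable def qMG (q : ℝ) (r : ℕ) (z : ℂ) : ℂ :=
  if r = 0 then (1 - (q : ℂ) ^ z) / (1 - (q : ℂ)) else
    (1 - (q : ℂ)) ^ (-genBinom (z - 1) r) *
      ∏' n : ℕ,
        (((1 - (q : ℂ) ^ ((z - 1) + (n + 1))) / (1 - (q : ℂ) ^ (n + 1)))
            ^ ((-1 : ℂ) ^ r * (Nat.choose (n + 1 + r - 2) (r - 1))) *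
          (1 - (q : ℂ) ^ (n + 1)) ^ (qg r (z - 1) (n + 1)))

open PowerSeries in
lemma coeff_binomialSeries_eq_genBinom (z : ℂ) (k : ℕ) :
    coeff k (binomialSeries ℂ z) = genBinom z k := by
  have h := Ring.descPochhammer_eq_factorial_smul_choose z k
  rw [← Polynomial.aeval_eq_smeval, Polynomial.aeval_def, ← Polynomial.eval_map,
    descPochhammer_map, descPochhammer_eval_eq_prod_range, nsmul_eq_mul] at h
  rw [binomialSeries_coeff, smul_eq_mul, mul_one, genBinom, h, mul_div_cancel_left₀]
  exact_mod_cast k.factorial_ne_zero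

/-- The principal logarithm of `1 - q ^ w`. -/
noncomputable def logOneSubCpow (q : ℝ) (w : ℂ) : ℂ := Complex.log (1 - (q : ℂ) ^ w)

/-- The logarithm of `∏_{n ≥ 0} (1 - q ^ (z + n + 1)) ^ ((-1) ^ r * multichoose r n)`. -/
noncomputable def logPochhammer (q : ℝ) (r : ℕ) (z : ℂ) : ℂ :=
  ∑' n : ℕ, (-1 : ℂ) ^ r * Nat.multichoose r n * logOneSubCpow q (z + n + 1)

/-- A logarithm of `qMG q r (z + 1)`. -/
noncomputable def logQMG (q : ℝ) (r : ℕ) (z : ℂ) : ℂ :=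
  logPochhammer q r z -
    PowerSeries.coeff r (PowerSeries.binomialSeries ℂ z *
      PowerSeries.mk fun m => logPochhammer q m 0)

section

variable {q : ℝ} (hq : 0 < q) (hq1 : q < 1)
include hq

lemma norm_ofReal_cpow (w : ℂ) : ‖(q : ℂ) ^ w‖ = q ^ w.re :=
  Complex.norm_cpow_eq_rpow_re_of_pos hq w

include hq1

lemma one_sub_cpow_ne_zero {w : ℂ} (hw : 0 < w.re) : 1 - (q : ℂ) ^ w ≠ 0 := by
  intro h
  have h1 := norm_ofReal_cpow hq w
  rw [← sub_eq_zero.mp h, norm_one] at h1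
  exact absurd (Real.rpow_lt_one hq.le hq1 hw) (by rw [← h1]; exact lt_irrefl _)

lemma exp_logOneSubCpow {w : ℂ} (hw : 0 < w.re) :
    Complex.exp (logOneSubCpow q w) = 1 - (q : ℂ) ^ w :=
  Complex.exp_log (one_sub_cpow_ne_zero hq hq1 hw)

lemma norm_logOneSubCpow_le {a : ℝ} (ha : 0 < a) {w : ℂ} (hw : a ≤ w.re) :
    ‖logOneSubCpow q w‖ ≤ ((1 - q ^ a)⁻¹ + 1) * q ^ w.re := by
  have hn := norm_ofReal_cpow hq w
  have hle : q ^ w.re ≤ q ^ a := Real.rpow_le_rpow_of_exponent_ge hq hq1.le hw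
  have ha1 : q ^ a < 1 := Real.rpow_lt_one hq.le hq1 ha
  have h := Complex.norm_log_one_add_le (z := -(q : ℂ) ^ w) (by rw [norm_neg, hn]; linarith)
  rw [← sub_eq_add_neg, norm_neg, hn] at h
  have hpos : 0 < q ^ w.re := Real.rpow_pos_of_pos hq _
  have hinv : (1 - q ^ w.re)⁻¹ ≤ (1 - q ^ a)⁻¹ := inv_anti₀ (by linarith) (by linarith)
  have hinv0 : 0 < (1 - q ^ w.re)⁻¹ := inv_pos.2 (by linarith)
  refine h.trans ?_
  have h1 : q ^ w.re * (1 - q ^ w.re)⁻¹ ≤ 1 * (1 - q ^ a)⁻¹ := by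
    gcongr
    linarith
  nlinarith [mul_le_mul_of_nonneg_left h1 hpos.le, mul_pos hpos hinv0, mul_pos (mul_pos hpos hpos) hinv0]

omit hq hq1 in
lemma multichoose_le_choose (r n : ℕ) : Nat.multichoose r n ≤ (n + r).choose r := by
  rw [Nat.multichoose_eq, add_comm n r, Nat.choose_symm_add]
  exact Nat.choose_le_choose _ (Nat.sub_le _ _)

/-- A bound, uniform in the half-plane `a ≤ re w`, for the terms of `logPochhammer`. -/
lemma norm_logPochhammer_term_le {a : ℝ} (ha : 0 < a) (r n : ℕ) {z : ℂ} (hz : a ≤ z.re + 1) :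
    ‖(-1 : ℂ) ^ r * Nat.multichoose r n * logOneSubCpow q (z + n + 1)‖ ≤
      ((1 - q ^ a)⁻¹ + 1) * (((n + r).choose r : ℝ) * q ^ n) := by
  have hre : (z + n + 1).re = z.re + 1 + n := by simp; ring
  have hl := norm_logOneSubCpow_le hq hq1 (w := z + n + 1) ha
    (by rw [hre]; linarith [n.cast_nonneg (α := ℝ)])
  have hC : 0 < (1 - q ^ a)⁻¹ + 1 := by
    have := inv_pos.2 (sub_pos.2 (Real.rpow_lt_one hq.le hq1 ha))
    linarith
  have hp : q ^ (z + n + 1).re ≤ q ^ n := by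
    rw [← Real.rpow_natCast]
    exact Real.rpow_le_rpow_of_exponent_ge hq hq1.le (by rw [hre]; linarith)
  rw [norm_mul, norm_mul, norm_pow, norm_neg, norm_one, one_pow, one_mul, Complex.norm_natCast]
  calc (Nat.multichoose r n : ℝ) * ‖logOneSubCpow q (z + n + 1)‖
      ≤ ((n + r).choose r : ℝ) * (((1 - q ^ a)⁻¹ + 1) * q ^ n) := by
        gcongr
        · exact multichoose_le_choose r n
        · exact hl.trans (by gcongr)
    _ = _ := by ring

lemma summable_choose_mul_pow (r : ℕ) (C : ℝ) :
    Summable fun n : ℕ => C * (((n + r).choose r : ℝ) * q ^ n) :=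
  (summable_choose_mul_geometric_of_norm_lt_one r
    (by rwa [Real.norm_of_nonneg hq.le])).mul_left C

lemma summable_logPochhammer (r : ℕ) {z : ℂ} (hz : -1 < z.re) :
    Summable fun n : ℕ => (-1 : ℂ) ^ r * Nat.multichoose r n * logOneSubCpow q (z + n + 1) :=
  .of_norm_bounded (summable_choose_mul_pow hq hq1 r _) fun n =>
    norm_logPochhammer_term_le hq hq1 (a := z.re + 1) (by linarith) r n le_rfl

lemma tendsto_logPochhammer (r : ℕ) {z : ℂ} (hz : -1 < z.re) :
    Tendsto (fun N : ℕ => logPochhammer q r (z + N)) atTop (𝓝 0) := by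
  have hzero : (0 : ℂ) = ∑' _ : ℕ, (0 : ℂ) := tsum_zero.symm
  rw [hzero]
  have ha : 0 < z.re + 1 := by linarith
  refine tendsto_tsum_of_dominated_convergence (summable_choose_mul_pow hq hq1 r _) (fun n => ?_)
    (.of_forall fun N n => norm_logPochhammer_term_le hq hq1 (a := z.re + 1) ha r n
      (by simp))
  rw [← mul_zero ((-1 : ℂ) ^ r * Nat.multichoose r n)]
  refine tendsto_const_nhds.mul ?_
  refine squeeze_zero_norm (a := fun N : ℕ => ((1 - q ^ (z.re + 1))⁻¹ + 1) * q ^ N) (fun N => ?_) ?_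
  · have hre : (z + N + n + 1).re = z.re + 1 + n + N := by simp; ring
    have hn := n.cast_nonneg (α := ℝ)
    have hN := N.cast_nonneg (α := ℝ)
    refine (norm_logOneSubCpow_le hq hq1 ha (by rw [hre]; linarith)).trans ?_
    have := inv_pos.2 (sub_pos.2 (Real.rpow_lt_one hq.le hq1 ha))
    refine mul_le_mul_of_nonneg_left ?_ (by linarith)
    rw [← Real.rpow_natCast]
    exact Real.rpow_le_rpow_of_exponent_ge hq hq1.le (by rw [hre]; linarith)
  · simpa using (tendsto_pow_atTop_nhds_zero_of_lt_one hq.le hq1).const_mul _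

lemma logPochhammer_succ_sub (r : ℕ) {z : ℂ} (hz : -1 < z.re) :
    logPochhammer q (r + 1) (z + 1) - logPochhammer q (r + 1) z = logPochhammer q r z := by
  have h0 := summable_logPochhammer hq hq1 (r + 1) hz
  have h1 := summable_logPochhammer hq hq1 (r + 1) (z := z + 1) (by simp; linarith)
  have h2 := summable_logPochhammer hq hq1 r hz
  rw [logPochhammer, logPochhammer, logPochhammer, h0.tsum_eq_zero_add, h2.tsum_eq_zero_add,
    sub_add_eq_sub_sub_swap, ← h1.tsum_sub ((summable_nat_add_iff 1).2 h0), sub_eq_add_neg, add_comm]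
  congr 1
  · simp [pow_succ]
  · refine tsum_congr fun n => ?_
    rw [Nat.multichoose_succ_succ, show z + 1 + n + 1 = z + (n + 1 : ℕ) + 1 by push_cast; ring]
    push_cast
    ring

omit hq hq1 in
lemma coeff_succ_binomialSeries_add_one_mul (r : ℕ) (z : ℂ) (K : PowerSeries ℂ) :
    PowerSeries.coeff (r + 1) (PowerSeries.binomialSeries ℂ (z + 1) * K) =
      PowerSeries.coeff (r + 1) (PowerSeries.binomialSeries ℂ z * K) +
        PowerSeries.coeff r (PowerSeries.binomialSeries ℂ z * K) := by
  have h := PowerSeries.binomialSeries_nat (R := ℂ) (A := ℂ) 1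
  rw [Nat.cast_one, pow_one] at h
  rw [PowerSeries.binomialSeries_add, h, mul_add, mul_one, add_mul, map_add, mul_comm _ PowerSeries.X,
    mul_assoc, PowerSeries.coeff_succ_X_mul]

lemma logQMG_succ_sub (r : ℕ) {z : ℂ} (hz : -1 < z.re) :
    logQMG q (r + 1) (z + 1) - logQMG q (r + 1) z = logQMG q r z := by
  rw [logQMG, logQMG, logQMG, coeff_succ_binomialSeries_add_one_mul,
    ← logPochhammer_succ_sub hq hq1 r hz]
  ring

lemma sum_range_logQMG (r : ℕ) {z : ℂ} (hz : -1 < z.re) (N : ℕ) :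
    ∑ k ∈ range N, logQMG q r (z + k) = logQMG q (r + 1) (z + N) - logQMG q (r + 1) z := by
  induction N with
  | zero => simp
  | succ N ih =>
    have hre : -1 < (z + N).re := by simp; linarith [N.cast_nonneg (α := ℝ)]
    rw [sum_range_succ, ih, ← logQMG_succ_sub hq hq1 r hre, Nat.cast_succ, ← add_assoc]
    ring

omit hq hq1 in
lemma logQMG_zero_right (r : ℕ) : logQMG q r 0 = 0 := by
  simp [logQMG]

lemma exists_ofReal_eq_logOneSubCpow {x : ℝ} (hx : 0 < x) : ∃ y : ℝ, logOneSubCpow q x = y := by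
  refine ⟨Real.log (1 - q ^ x), ?_⟩
  rw [logOneSubCpow, Complex.ofReal_log (by linarith [Real.rpow_lt_one hq.le hq1 hx])]
  push_cast [Complex.ofReal_cpow hq.le]
  rfl

lemma logPochhammer_natCast_im (r N : ℕ) : (logPochhammer q r N).im = 0 := by
  rw [logPochhammer, Complex.im_tsum (summable_logPochhammer hq hq1 r
    (by simp; linarith [N.cast_nonneg (α := ℝ)]))]
  refine (tsum_congr fun n => ?_).trans tsum_zero
  obtain ⟨y, hy⟩ := exists_ofReal_eq_logOneSubCpow hq hq1 (x := (N + n + 1 : ℝ)) (by positivity)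
  push_cast at hy
  rw [hy]
  norm_cast

lemma logQMG_natCast_im (r N : ℕ) : (logQMG q r N).im = 0 := by
  have h0 (m : ℕ) : (logPochhammer q m 0).im = 0 := by
    simpa using logPochhammer_natCast_im hq hq1 m 0
  rw [logQMG, Complex.sub_im, logPochhammer_natCast_im hq hq1, PowerSeries.coeff_mul, Complex.im_sum,
    sum_eq_zero, sub_zero]
  intro p _
  rw [PowerSeries.coeff_mk, PowerSeries.binomialSeries_coeff, Ring.choose_natCast]
  simp [h0]

lemma exp_logQMG_natCast_cpow (r N : ℕ) (c : ℂ) :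
    Complex.exp (logQMG q r N) ^ c = Complex.exp (c * logQMG q r N) := by
  rw [Complex.cpow_def_of_ne_zero (Complex.exp_ne_zero _), Complex.log_exp, mul_comm] <;>
    rw [logQMG_natCast_im hq hq1]
  · exact neg_lt_zero.2 Real.pi_pos
  · exact Real.pi_pos.le

omit hq hq1 in
lemma qg_succ_succ (r n : ℕ) (z : ℂ) :
    qg (r + 1) z (n + 1) = -∑ m ∈ Ico 1 (r + 1),
      genBinom z (r + 1 - m) * ((-1) ^ m * Nat.multichoose m n) := by
  rw [qg, Nat.add_sub_cancel, ← sum_neg_distrib]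
  refine sum_congr (by ext; simp) fun m hm => ?_
  obtain ⟨k, rfl⟩ : ∃ k, m = k + 1 := ⟨m - 1, by simp at hm; omega⟩
  rw [Nat.multichoose_eq, show k + 1 + n - 1 = k + n by omega, ← Nat.choose_symm_add,
    show n + 1 + (k + 1) - 2 = k + n by omega, Nat.add_sub_cancel]
  ring

lemma cpow_logOneSubCpow (n : ℕ) (c : ℂ) :
    (1 - (q : ℂ) ^ (n + 1)) ^ c = Complex.exp (c * logOneSubCpow q (n + 1)) := by
  have h := one_sub_cpow_ne_zero hq hq1 (w := (n + 1 : ℕ)) (by simp; positivity)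
  rw [Complex.cpow_natCast] at h
  rw [Complex.cpow_def_of_ne_zero h, logOneSubCpow, mul_comm]
  norm_cast

/-- The `n`-th factor of the product defining `qMG q (r + 1) (z + 1)`. -/
lemma qMG_factor_eq_exp (r n : ℕ) {z : ℂ} (hz : -1 < z.re) :
    ((1 - (q : ℂ) ^ (z + (n + 1))) / (1 - (q : ℂ) ^ (n + 1)))
        ^ ((-1 : ℂ) ^ (r + 1) * (Nat.choose (n + 1 + (r + 1) - 2) (r + 1 - 1))) *
      (1 - (q : ℂ) ^ (n + 1)) ^ (qg (r + 1) z (n + 1)) =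
    Complex.exp ((-1 : ℂ) ^ (r + 1) * Nat.multichoose (r + 1) n * logOneSubCpow q (z + n + 1) -
      ∑ m ∈ Ico 1 (r + 2), genBinom z (r + 1 - m) *
        ((-1) ^ m * Nat.multichoose m n * logOneSubCpow q (0 + n + 1))) := by
  have h1 := exp_logOneSubCpow hq hq1 (w := z + n + 1)
    (by simp; linarith [n.cast_nonneg (α := ℝ)])
  have h2 := exp_logOneSubCpow hq hq1 (w := (n + 1 : ℕ)) (by simp; positivity)
  rw [Complex.cpow_natCast] at h2
  have hch : Nat.choose (n + 1 + (r + 1) - 2) (r + 1 - 1) = Nat.multichoose (r + 1) n := by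
    rw [Nat.multichoose_eq, show r + 1 + n - 1 = r + n by omega, ← Nat.choose_symm_add,
      show n + 1 + (r + 1) - 2 = r + n by omega, Nat.add_sub_cancel]
  have hint : (-1 : ℂ) ^ (r + 1) * (Nat.multichoose (r + 1) n : ℂ) =
      (((-1) ^ (r + 1) * (Nat.multichoose (r + 1) n : ℤ) : ℤ) : ℂ) := by push_cast; rfl
  rw [hch, cpow_logOneSubCpow hq hq1, ← add_assoc, ← h1, ← h2, ← Complex.exp_sub, hint,
    Complex.cpow_intCast, ← Complex.exp_int_mul, ← Complex.exp_add, sum_Ico_succ_top (by omega),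
    qg_succ_succ, ← hint, Nat.sub_self, zero_add]
  congr 1
  simp only [← mul_assoc, ← sum_mul, genBinom, range_zero, prod_empty, Nat.factorial_zero]
  push_cast
  ring

omit hq hq1 in
lemma coeff_binomialSeries_mul_mk (r : ℕ) (z : ℂ) (f : ℕ → ℂ) :
    PowerSeries.coeff r (PowerSeries.binomialSeries ℂ z * PowerSeries.mk f) =
      ∑ m ∈ range (r + 1), genBinom z (r - m) * f m := by
  rw [mul_comm, PowerSeries.coeff_mul, Nat.sum_antidiagonal_eq_sum_range_succ_mk]
  refine sum_congr rfl fun m _ => ?_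
  rw [coeff_binomialSeries_eq_genBinom, PowerSeries.coeff_mk, mul_comm]

omit hq hq1 in
lemma logPochhammer_zero_left (z : ℂ) : logPochhammer q 0 z = logOneSubCpow q (z + 1) := by
  rw [logPochhammer, tsum_eq_single 0]
  · simp
  · intro n hn
    obtain ⟨k, rfl⟩ := Nat.exists_eq_succ_of_ne_zero hn
    simp

/-- The infinite product `qMG q r (z + 1)` converges to the exponential of `logQMG q r z`. -/
lemma qMG_add_one_eq_exp (r : ℕ) {z : ℂ} (hz : -1 < z.re) :
    qMG q r (z + 1) = Complex.exp (logQMG q r z) := by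
  have hL : Complex.exp (logOneSubCpow q 1) = 1 - q := by
    simpa using exp_logOneSubCpow hq hq1 (w := 1) (by simp)
  rw [logQMG, coeff_binomialSeries_mul_mk]
  rcases r with _ | r
  · rw [qMG, if_pos rfl, ← exp_logOneSubCpow hq hq1 (by simp; linarith), ← hL, ← Complex.exp_sub]
    simp [logPochhammer_zero_left, genBinom]
  · have hsum := (summable_logPochhammer hq hq1 (r + 1) hz).hasSum.sub
      (hasSum_sum (s := Ico 1 (r + 2)) fun m _ =>
        (summable_logPochhammer hq hq1 m (z := 0) (by simp)).hasSum.mul_left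
          (genBinom z (r + 1 - m)))
    rw [qMG, if_neg r.succ_ne_zero, add_sub_cancel_right]
    simp only [qMG_factor_eq_exp hq hq1 r _ hz]
    have hprod := hsum.cexp.tprod_eq
    simp only [Function.comp_apply] at hprod
    rw [range_eq_Ico, sum_eq_sum_Ico_succ_bot (by omega), Nat.sub_zero, logPochhammer_zero_left,
      zero_add, hprod]
    have hc := cpow_logOneSubCpow hq hq1 0 (-genBinom z (r + 1))
    rw [zero_add, pow_one, Nat.cast_zero, zero_add] at hc
    rw [hc, ← Complex.exp_add]
    congr 1
    simp only [logPochhammer]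
    ring

omit hq hq1 in
lemma logQMG_add_natCast (r N : ℕ) (z : ℂ) :
    logQMG q r (z + N) = logPochhammer q r (z + N) +
      ∑ p ∈ antidiagonal r, genBinom z p.1 * (logQMG q p.2 N - logPochhammer q p.2 N) := by
  rw [logQMG, PowerSeries.binomialSeries_add, mul_assoc, PowerSeries.coeff_mul, sub_eq_add_neg,
    ← sum_neg_distrib]
  congr 1
  refine sum_congr rfl fun p _ => ?_
  rw [coeff_binomialSeries_eq_genBinom, logQMG]
  ring

end

theorem stmt17 (q : ℝ) (hq : 0 < q) (hq1 : q < 1) (r : ℕ) (hr : 1 ≤ r) (z : ℂ) (hz : 0 < z.re) :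
    Tendsto (fun N : ℕ =>
        ((∏ k ∈ Finset.range N, qMG q (r - 1) (k + 1)) /
            (∏ k ∈ Finset.range N, qMG q (r - 1) (z + k + 1))) *
          ∏ m ∈ Finset.Icc 1 r, (qMG q (r - m) ((N : ℂ) + 1)) ^ (genBinom z m))
      atTop (𝓝 (qMG q r (z + 1))) := by
  obtain ⟨s, rfl⟩ : ∃ s, r = s + 1 := ⟨r - 1, by omega⟩
  have hz1 : -1 < z.re := by linarith
  have hnat (k : ℕ) : -1 < (k : ℂ).re := by simp; linarith [k.cast_nonneg (α := ℝ)]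
  have hlim : Tendsto (fun N : ℕ => logQMG q (s + 1) z - logPochhammer q (s + 1) (z + N) +
      ∑ p ∈ antidiagonal (s + 1), genBinom z p.1 * logPochhammer q p.2 N) atTop
      (𝓝 (logQMG q (s + 1) z)) := by
    have h1 := (tendsto_logPochhammer hq hq1 (s + 1) hz1).const_sub (logQMG q (s + 1) z)
    have h2 : Tendsto (fun N : ℕ => ∑ p ∈ antidiagonal (s + 1),
        genBinom z p.1 * logPochhammer q p.2 N) atTop (𝓝 (∑ p ∈ antidiagonal (s + 1), 0)) :=
      tendsto_finsetSum _ fun p _ => by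
        simpa using (tendsto_logPochhammer hq hq1 p.2 (z := 0) (by simp)).const_mul
          (genBinom z p.1)
    simpa using h1.add h2
  rw [qMG_add_one_eq_exp hq hq1 _ hz1]
  refine ((Complex.continuous_exp.tendsto _).comp hlim).congr fun N => ?_
  have hnum : ∏ k ∈ range N, qMG q s (k + 1) = Complex.exp (logQMG q (s + 1) N) := by
    have h := sum_range_logQMG hq hq1 s (z := 0) (by simp) N
    simp only [zero_add, logQMG_zero_right, sub_zero] at h
    rw [← h, Complex.exp_sum]
    exact prod_congr rfl fun k _ => qMG_add_one_eq_exp hq hq1 s (hnat k)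
  have hden : ∏ k ∈ range N, qMG q s (z + k + 1) =
      Complex.exp (logQMG q (s + 1) (z + N) - logQMG q (s + 1) z) := by
    rw [← sum_range_logQMG hq hq1 s hz1 N, Complex.exp_sum]
    refine prod_congr rfl fun k _ => qMG_add_one_eq_exp hq hq1 s ?_
    rw [Complex.add_re]
    simp
    linarith [k.cast_nonneg (α := ℝ)]
  have hpow : ∏ m ∈ Icc 1 (s + 1), qMG q (s + 1 - m) ((N : ℂ) + 1) ^ genBinom z m =
      Complex.exp (∑ m ∈ Ico 1 (s + 2), genBinom z m * logQMG q (s + 1 - m) N) := by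
    rw [Complex.exp_sum]
    refine prod_congr (by ext; simp; omega) fun m _ => ?_
    rw [qMG_add_one_eq_exp hq hq1 _ (hnat N), exp_logQMG_natCast_cpow hq hq1]
  have hsplit : ∑ p ∈ antidiagonal (s + 1), genBinom z p.1 * logQMG q p.2 N =
      logQMG q (s + 1) N + ∑ m ∈ Ico 1 (s + 2), genBinom z m * logQMG q (s + 1 - m) N := by
    rw [Nat.sum_antidiagonal_eq_sum_range_succ_mk, range_eq_Ico,
      sum_eq_sum_Ico_succ_bot (by omega)]
    simp [genBinom]
  rw [Nat.add_sub_cancel, hnum, hden, hpow, ← Complex.exp_sub, ← Complex.exp_add,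
    Function.comp_apply, logQMG_add_natCast]
  simp only [mul_sub, sum_sub_distrib, hsplit]
  congr 1
  ring
end

section
/- Let 0 < q < 1, r ≥ 1, and Re z > 0. Then G_r(z+1;q) = ∏_{n=1}^{∞} ( G_{r-1}(n;q)/G_{r-1}(z+n;q) ) ∏_{m=1}^{r} ( G_{r-m}(n+1;q)/G_{r-m}(n;q) )^{C(z,m)}, a q-analogue of Euler's product formula for the multiple gamma function. -/
open Finset Filter Topology

theorem genBinom_eq_choose (z : ℂ) (k : ℕ) : genBinom z k = Ring.choose z k := by
  rw [Ring.choose_eq_smul, genBinom, div_eq_inv_mul, smul_eq_mul,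
    ← Polynomial.aeval_eq_smeval, Polynomial.aeval_def, Polynomial.eval₂_eq_eval_map,
    descPochhammer_map, descPochhammer_eval_eq_prod_range]

/-- The term `(-1)^k C(n+k-1, n) log(1 - q^{w+n})`. -/
noncomputable def logTerm (q : ℝ) (k : ℕ) (w : ℂ) (n : ℕ) : ℂ :=
  (-1) ^ k * (Nat.multichoose k n : ℂ) * Complex.log (1 - (q : ℂ) ^ (w + n))

/-- The series `∑ (-1)^k C(n+k-1, n) log(1 - q^{w+n})`. -/
noncomputable def logSum (q : ℝ) (k : ℕ) (w : ℂ) : ℂ := ∑' n, logTerm q k w n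

/-- The generating series in `k` of the logarithms of `qMG q k w`. -/
noncomputable def logSeries (q : ℝ) (w : ℂ) : PowerSeries ℂ :=
  PowerSeries.mk (fun k => logSum q k w) -
    PowerSeries.binomialSeries ℂ (w - 1) * PowerSeries.mk (fun k => logSum q k 1)

theorem norm_ofReal_cpow_add_natCast {q : ℝ} (hq : 0 < q) (w : ℂ) (n : ℕ) :
    ‖(q : ℂ) ^ (w + n)‖ = q ^ w.re * q ^ n := by
  rw [Complex.norm_cpow_eq_rpow_re_of_pos hq, Complex.add_re, Complex.natCast_re,
    Real.rpow_add hq, Real.rpow_natCast]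

theorem norm_log_one_sub_cpow_le {q : ℝ} (hq : 0 < q) (hq1 : q < 1) {w : ℂ} (hw : 0 < w.re)
    (n : ℕ) :
    ‖Complex.log (1 - (q : ℂ) ^ (w + n))‖ ≤ ((1 - q ^ w.re)⁻¹ + 1) * q ^ n := by
  have hρ : q ^ w.re < 1 := Real.rpow_lt_one hq.le hq1 hw
  have hρ0 : 0 < q ^ w.re := Real.rpow_pos_of_pos hq _
  have hn0 : 0 < q ^ n := pow_pos hq n
  have hn1 : q ^ n ≤ 1 := pow_le_one₀ hq.le hq1.le
  have hx := norm_ofReal_cpow_add_natCast hq w n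
  set x := (q : ℂ) ^ (w + n)
  have hxρ : ‖x‖ ≤ q ^ w.re := by rw [hx]; nlinarith
  have hxn : ‖x‖ ≤ q ^ n := by rw [hx]; nlinarith
  have hlog := Complex.norm_log_one_add_le (z := -x) (by rw [norm_neg]; linarith)
  rw [norm_neg, ← sub_eq_add_neg] at hlog
  have hinv : (1 - ‖x‖)⁻¹ ≤ (1 - q ^ w.re)⁻¹ := inv_anti₀ (by linarith) (by linarith)
  have hinv0 : 0 < (1 - ‖x‖)⁻¹ := inv_pos.2 (by linarith)
  have hx0 := norm_nonneg x
  calc _ ≤ _ := hlog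
    _ ≤ ‖x‖ * (1 - q ^ w.re)⁻¹ + ‖x‖ := by
      have h1 : ‖x‖ ^ 2 / 2 ≤ ‖x‖ := by nlinarith
      have h2 : ‖x‖ ^ 2 * (1 - ‖x‖)⁻¹ / 2 = ‖x‖ ^ 2 / 2 * (1 - ‖x‖)⁻¹ := by ring
      rw [h2]
      gcongr
    _ = ((1 - q ^ w.re)⁻¹ + 1) * ‖x‖ := by ring
    _ ≤ _ := by
      have : 0 < (1 - q ^ w.re)⁻¹ := inv_pos.2 (by linarith)
      gcongr

theorem summable_multichoose_mul_pow {q : ℝ} (hq : 0 < q) (hq1 : q < 1) (k : ℕ) :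
    Summable fun n => (Nat.multichoose k n : ℝ) * q ^ n := by
  cases k with
  | zero =>
    refine summable_of_ne_finset_zero (s := {0}) fun n hn => ?_
    cases n with
    | zero => simp at hn
    | succ n => simp [Nat.multichoose_zero_succ]
  | succ k =>
    refine (summable_choose_mul_geometric_of_norm_lt_one k
      (by rwa [Real.norm_of_nonneg hq.le] : ‖q‖ < 1)).congr fun n => ?_
    rw [Nat.multichoose_eq, show k + 1 + n - 1 = n + k by omega, Nat.choose_symm_add]

theorem norm_logTerm_add_natCast_le {q : ℝ} (hq : 0 < q) (hq1 : q < 1) (k : ℕ) {w : ℂ}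
    (hw : 0 < w.re) (m n : ℕ) :
    ‖logTerm q k (w + m) n‖ ≤
      ((1 - q ^ w.re)⁻¹ + 1) * q ^ m * ((Nat.multichoose k n : ℝ) * q ^ n) := by
  have h := norm_log_one_sub_cpow_le hq hq1 hw (m + n)
  rw [logTerm, norm_mul, norm_mul, norm_pow, norm_neg, norm_one, one_pow, one_mul,
    Complex.norm_natCast, add_assoc, ← Nat.cast_add]
  calc _ ≤ (Nat.multichoose k n : ℝ) * (((1 - q ^ w.re)⁻¹ + 1) * q ^ (m + n)) := by gcongr
    _ = _ := by ring

theorem summable_logTerm {q : ℝ} (hq : 0 < q) (hq1 : q < 1) (k : ℕ) {w : ℂ} (hw : 0 < w.re) :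
    Summable (logTerm q k w) := by
  refine Summable.of_norm_bounded
    ((summable_multichoose_mul_pow hq hq1 k).mul_left ((1 - q ^ w.re)⁻¹ + 1)) fun n => ?_
  simpa using norm_logTerm_add_natCast_le hq hq1 k hw 0 n

theorem summable_logSum_add_natCast {q : ℝ} (hq : 0 < q) (hq1 : q < 1) (k : ℕ) {w : ℂ}
    (hw : 0 < w.re) : Summable fun m : ℕ => logSum q k (w + m) := by
  refine Summable.of_norm_bounded (((summable_geometric_of_lt_one hq.le hq1).mul_left
    ((1 - q ^ w.re)⁻¹ + 1)).mul_right (∑' n, (Nat.multichoose k n : ℝ) * q ^ n)) fun m => ?_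
  exact tsum_of_norm_bounded
    ((summable_multichoose_mul_pow hq hq1 k).hasSum.mul_left _)
    (norm_logTerm_add_natCast_le hq hq1 k hw m)

theorem logSum_succ_add_one {q : ℝ} (hq : 0 < q) (hq1 : q < 1) (k : ℕ) {w : ℂ}
    (hw : 0 < w.re) : logSum q (k + 1) (w + 1) = logSum q (k + 1) w + logSum q k w := by
  have h1 := summable_logTerm hq hq1 (k + 1) hw
  have h0 := summable_logTerm hq hq1 k hw
  rw [logSum, logSum, logSum, ← h1.tsum_add h0, (h1.add h0).tsum_eq_zero_add]
  have hz : logTerm q (k + 1) w 0 + logTerm q k w 0 = 0 := by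
    simp [logTerm, pow_succ]
  rw [hz, zero_add]
  refine tsum_congr fun n => ?_
  simp only [logTerm, Nat.multichoose_succ_succ]
  push_cast
  rw [show w + 1 + (n : ℂ) = w + (n + 1) by ring]
  ring

theorem logSum_im_natCast {q : ℝ} (hq : 0 < q) (hq1 : q < 1) (k m : ℕ) :
    (logSum q k (m + 1)).im = 0 := by
  have : ∀ n, logTerm q k (m + 1) n =
      (((-1) ^ k * (Nat.multichoose k n : ℝ) * Real.log (1 - q ^ (m + 1 + n)) : ℝ) : ℂ) := by
    intro n
    have hle : q ^ (m + 1 + n) ≤ 1 := pow_le_one₀ hq.le hq1.le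
    rw [logTerm, show (m : ℂ) + 1 + n = ((m + 1 + n : ℕ) : ℂ) by push_cast; ring,
      Complex.cpow_natCast]
    push_cast [Complex.ofReal_log (sub_nonneg.2 hle)]
    rfl
  rw [logSum, tsum_congr this, ← Complex.ofReal_tsum, Complex.ofReal_im]

theorem coeff_logSeries (q : ℝ) (k : ℕ) (w : ℂ) :
    PowerSeries.coeff k (logSeries q w) = logSum q k w -
      ∑ i ∈ range (k + 1), genBinom (w - 1) (k - i) * logSum q i 1 := by
  rw [logSeries, map_sub, PowerSeries.coeff_mk, mul_comm, PowerSeries.coeff_mul,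
    Finset.Nat.sum_antidiagonal_eq_sum_range_succ_mk]
  congr 1
  refine sum_congr rfl fun i _ => ?_
  rw [PowerSeries.coeff_mk, PowerSeries.binomialSeries_coeff, genBinom_eq_choose, smul_eq_mul,
    mul_one, mul_comm]

theorem logSeries_one (q : ℝ) : logSeries q 1 = 0 := by
  simp [logSeries]

theorem coeff_logSeries_add_one {q : ℝ} (hq : 0 < q) (hq1 : q < 1) (k : ℕ) {w : ℂ}
    (hw : 0 < w.re) :
    PowerSeries.coeff (k + 1) (logSeries q (w + 1)) =
      PowerSeries.coeff (k + 1) (logSeries q w) + PowerSeries.coeff k (logSeries q w) := by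
  have hb : PowerSeries.binomialSeries ℂ (w + 1 - 1) =
      PowerSeries.binomialSeries ℂ (w - 1) * (1 + PowerSeries.X) := by
    have h := PowerSeries.binomialSeries_add (A := ℂ) (w - 1) 1
    have h1 := PowerSeries.binomialSeries_nat (A := ℂ) (R := ℂ) 1
    rw [Nat.cast_one, pow_one] at h1
    rw [← h1, ← h]
    ring_nf
  have hm : PowerSeries.binomialSeries ℂ (w - 1) * (1 + PowerSeries.X) *
        PowerSeries.mk (fun k => logSum q k 1) =
      PowerSeries.binomialSeries ℂ (w - 1) * PowerSeries.mk (fun k => logSum q k 1) +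
      PowerSeries.X *
        (PowerSeries.binomialSeries ℂ (w - 1) * PowerSeries.mk (fun k => logSum q k 1)) := by
    ring
  simp only [logSeries, hb, hm, map_sub, map_add, PowerSeries.coeff_succ_X_mul,
    PowerSeries.coeff_mk, logSum_succ_add_one hq hq1 k hw]
  ring

theorem coeff_logSeries_im_natCast {q : ℝ} (hq : 0 < q) (hq1 : q < 1) (k m : ℕ) :
    (PowerSeries.coeff k (logSeries q (m + 1))).im = 0 := by
  have h1 : ∀ i, (logSum q i 1).im = 0 := fun i => by
    simpa using logSum_im_natCast hq hq1 i 0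
  rw [coeff_logSeries, Complex.sub_im, logSum_im_natCast hq hq1, Complex.im_sum, zero_sub,
    neg_eq_zero]
  refine sum_eq_zero fun i _ => ?_
  rw [genBinom_eq_choose, add_sub_cancel_right, Ring.choose_natCast, Complex.mul_im, h1,
    Complex.natCast_im]
  simp

theorem one_sub_ofReal_cpow_ne_zero {q : ℝ} (hq : 0 < q) (hq1 : q < 1) {w : ℂ}
    (hw : 0 < w.re) : 1 - (q : ℂ) ^ w ≠ 0 := by
  intro h
  have := norm_ofReal_cpow_add_natCast hq w 0
  rw [Nat.cast_zero, add_zero, ← sub_eq_zero.1 h] at this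
  have := Real.rpow_lt_one hq.le hq1 hw
  simp_all

theorem logSum_zero (q : ℝ) (w : ℂ) : logSum q 0 w = Complex.log (1 - (q : ℂ) ^ w) := by
  rw [logSum, tsum_eq_single 0]
  · simp [logTerm]
  · intro n hn
    obtain ⟨n, rfl⟩ := Nat.exists_eq_succ_of_ne_zero hn
    simp [logTerm, Nat.multichoose_zero_succ]

theorem qg_succ (k : ℕ) (x : ℂ) (n : ℕ) :
    qg (k + 1) x (n + 1) = (-1) ^ (k + 1) * (Nat.multichoose (k + 1) n : ℂ) -
      ∑ i ∈ range (k + 1),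
        genBinom x (k - i) * ((-1) ^ (i + 1) * (Nat.multichoose (i + 1) n : ℂ)) := by
  have hset : Icc 1 (k + 1 - 1) = Ico (0 + 1) (k + 1) := by ext; simp
  have h0 : genBinom x 0 = 1 := by simp [genBinom]
  rw [sum_range_succ, Nat.sub_self, h0, one_mul, qg, hset, ← sum_Ico_add', ← range_eq_Ico,
    sub_add_eq_sub_sub_swap, sub_self, zero_sub, ← sum_neg_distrib]
  refine sum_congr rfl fun i _ => ?_
  rw [Nat.multichoose_eq, show i + 1 + n - 1 = n + i by omega, Nat.choose_symm_add,
    show n + 1 + (i + 1) - 2 = n + i by omega, show k + 1 - (i + 1) = k - i by omega,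
    Nat.add_sub_cancel]
  ring

theorem qMG_eq_exp {q : ℝ} (hq : 0 < q) (hq1 : q < 1) (k : ℕ) {w : ℂ} (hw : 0 < w.re) :
    qMG q k w = Complex.exp (PowerSeries.coeff k (logSeries q w)) := by
  have hq0 : (1 - (q : ℂ)) ≠ 0 := by
    simpa using one_sub_ofReal_cpow_ne_zero hq hq1 (w := 1) (by simp)
  have hl1 : logSum q 0 1 = Complex.log (1 - (q : ℂ)) := by
    rw [logSum_zero, Complex.cpow_one]
  rw [coeff_logSeries]
  cases k with
  | zero =>
    have h0 : genBinom (w - 1) 0 = 1 := by simp [genBinom]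
    rw [qMG, if_pos rfl, zero_add, sum_range_one, logSum_zero, hl1, Nat.sub_zero, h0, one_mul,
      Complex.exp_sub, Complex.exp_log hq0,
      Complex.exp_log (one_sub_ofReal_cpow_ne_zero hq hq1 hw)]
  | succ k =>
    have hs : HasSum (fun n => logTerm q (k + 1) w n -
        ∑ i ∈ range (k + 1), genBinom (w - 1) (k - i) * logTerm q (i + 1) 1 n)
        (logSum q (k + 1) w -
          ∑ i ∈ range (k + 1), genBinom (w - 1) (k - i) * logSum q (i + 1) 1) :=
      (summable_logTerm hq hq1 (k + 1) hw).hasSum.sub (hasSum_sum fun i _ =>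
        (summable_logTerm hq hq1 (i + 1) (by simp)).hasSum.mul_left _)
    rw [qMG, if_neg k.succ_ne_zero, sum_range_succ', Nat.sub_zero, hl1,
      Complex.cpow_def_of_ne_zero hq0]
    simp only [Nat.add_sub_add_right]
    rw [sub_add_eq_sub_sub, sub_eq_neg_add _ (genBinom _ _ * _), Complex.exp_add, ← hs.cexp.tprod_eq]
    congr 1
    · ring_nf
    refine tprod_congr fun n => ?_
    have hwn : 0 < (w + n).re := by
      rw [Complex.add_re, Complex.natCast_re]; positivity
    have hX := one_sub_ofReal_cpow_ne_zero hq hq1 hwn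
    have hpow : (q : ℂ) ^ (n + 1) = (q : ℂ) ^ ((1 : ℂ) + n) := by
      rw [← Complex.cpow_natCast]; push_cast; ring_nf
    have hY : 1 - (q : ℂ) ^ ((1 : ℂ) + n) ≠ 0 := one_sub_ofReal_cpow_ne_zero hq hq1 (by
      rw [Complex.add_re, Complex.natCast_re, Complex.one_re]; positivity)
    have hc : (-1 : ℂ) ^ (k + 1) * (Nat.choose (n + 1 + (k + 1) - 2) (k + 1 - 1) : ℂ) =
        (((-1) ^ (k + 1) * (Nat.multichoose (k + 1) n : ℤ) : ℤ) : ℂ) := by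
      rw [Nat.multichoose_eq, show k + 1 + n - 1 = n + k by omega, Nat.choose_symm_add,
        show n + 1 + (k + 1) - 2 = n + k by omega, Nat.add_sub_cancel]
      push_cast
      rfl
    have hbase : ∀ N : ℤ, ((1 - (q : ℂ) ^ (w + n)) / (1 - (q : ℂ) ^ ((1 : ℂ) + n))) ^ N =
        Complex.exp (N * (Complex.log (1 - (q : ℂ) ^ (w + n)) -
          Complex.log (1 - (q : ℂ) ^ ((1 : ℂ) + n)))) := fun N => by
      rw [Complex.exp_int_mul, Complex.exp_sub, Complex.exp_log hX, Complex.exp_log hY]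
    rw [hpow, hc, show w - 1 + ((n : ℂ) + 1) = w + n by ring, Complex.cpow_intCast, hbase,
      Complex.cpow_def_of_ne_zero hY, qg_succ, ← Complex.exp_add, Function.comp_apply]
    congr 1
    simp only [logTerm, ← mul_assoc, ← sum_mul]
    push_cast
    ring

/-- The logarithm of `qMG q r (z + n + 1)` divided by
`∏_{m ≤ r} qMG q (r - m) (n + 1) ^ genBinom z m`. -/
noncomputable def logRemainder (q : ℝ) (r : ℕ) (z : ℂ) (n : ℕ) : ℂ :=
  PowerSeries.coeff r (logSeries q (z + n + 1)) -
    ∑ m ∈ range (r + 1), genBinom z m * PowerSeries.coeff (r - m) (logSeries q (n + 1))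

theorem logRemainder_eq (q : ℝ) (r : ℕ) (z : ℂ) (n : ℕ) :
    logRemainder q r z n = logSum q r (z + 1 + n) -
      ∑ m ∈ range (r + 1), genBinom z m * logSum q (r - m) (1 + n) := by
  have key : ∀ f : PowerSeries ℂ, ∑ m ∈ range (r + 1), genBinom z m * PowerSeries.coeff (r - m) f =
      PowerSeries.coeff r (PowerSeries.binomialSeries ℂ z * f) := by
    intro f
    rw [PowerSeries.coeff_mul, Finset.Nat.sum_antidiagonal_eq_sum_range_succ_mk]
    refine sum_congr rfl fun i _ => ?_
    rw [PowerSeries.binomialSeries_coeff, genBinom_eq_choose, smul_eq_mul, mul_one]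
  have key' := key (PowerSeries.mk fun k => logSum q k (1 + n))
  simp only [PowerSeries.coeff_mk] at key'
  rw [logRemainder, key, key', logSeries, logSeries, show z + n + 1 - 1 = z + n by ring,
    PowerSeries.binomialSeries_add, mul_sub, map_sub, map_sub, PowerSeries.coeff_mk,
    add_sub_cancel_right, mul_assoc, show z + n + 1 = z + 1 + n by ring,
    add_comm (n : ℂ) 1]
  ring

theorem summable_logRemainder {q : ℝ} (hq : 0 < q) (hq1 : q < 1) (r : ℕ) {z : ℂ}
    (hz : 0 < z.re) : Summable (logRemainder q r z) := by
  rw [funext (logRemainder_eq q r z)]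
  refine (summable_logSum_add_natCast hq hq1 r ?_).sub (summable_sum fun m _ =>
    (summable_logSum_add_natCast hq hq1 (r - m) (by simp)).mul_left _)
  rw [Complex.add_re, Complex.one_re]
  positivity

theorem logRemainder_zero (q : ℝ) (r : ℕ) (z : ℂ) :
    logRemainder q r z 0 = PowerSeries.coeff r (logSeries q (z + 1)) := by
  simp [logRemainder, logSeries_one]

theorem exp_div_exp_cpow {x y : ℂ} (hx : x.im = 0) (hy : y.im = 0) (c : ℂ) :
    (Complex.exp x / Complex.exp y) ^ c = Complex.exp (c * (x - y)) := by
  have h : (x - y).im = 0 := by simp [hx, hy]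
  rw [← Complex.exp_sub, Complex.cpow_def_of_ne_zero (Complex.exp_ne_zero _),
    Complex.log_exp (by simp [h, Real.pi_pos]) (by simp [h, Real.pi_pos.le]), mul_comm]

theorem stmt18 (q : ℝ) (hq : 0 < q) (hq1 : q < 1) (r : ℕ) (hr : 1 ≤ r) (z : ℂ) (hz : 0 < z.re) :
    qMG q r (z + 1)
      = ∏' n : ℕ,
          ((qMG q (r - 1) ((n : ℂ) + 1) / qMG q (r - 1) (z + n + 1)) *
            ∏ m ∈ Finset.Icc 1 r,
              (qMG q (r - m) ((n : ℂ) + 2) / qMG q (r - m) ((n : ℂ) + 1)) ^ (genBinom z m)) := by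
  obtain ⟨k, rfl⟩ := Nat.exists_eq_add_of_le' hr
  have hs := summable_logRemainder hq hq1 (k + 1) hz
  have hT : HasSum (fun n => logRemainder q (k + 1) z n - logRemainder q (k + 1) z (n + 1))
      (logRemainder q (k + 1) z 0) := by
    have h := hs.hasSum.sub ((summable_nat_add_iff 1).2 hs).hasSum
    rwa [hs.tsum_eq_zero_add, add_sub_cancel_right] at h
  rw [qMG_eq_exp hq hq1 (k + 1) (by rw [Complex.add_re, Complex.one_re]; positivity),
    ← logRemainder_zero, ← hT.cexp.tprod_eq]
  refine tprod_congr fun n => ?_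
  have hn : 0 < ((n : ℂ) + 1).re := by
    rw [Complex.add_re, Complex.natCast_re, Complex.one_re]; positivity
  have hn2 : 0 < ((n : ℂ) + 2).re := by
    rw [Complex.add_re, Complex.natCast_re, Complex.re_ofNat]; positivity
  have hzn : 0 < (z + n + 1).re := by
    rw [Complex.add_re, Complex.add_re, Complex.natCast_re, Complex.one_re]; positivity
  have hprod : ∀ m, (qMG q (k + 1 - m) ((n : ℂ) + 2) / qMG q (k + 1 - m) ((n : ℂ) + 1)) ^
      genBinom z m = Complex.exp (genBinom z m *
        (PowerSeries.coeff (k + 1 - m) (logSeries q (n + 2)) -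
          PowerSeries.coeff (k + 1 - m) (logSeries q (n + 1)))) := by
    intro m
    rw [qMG_eq_exp hq hq1 _ hn, qMG_eq_exp hq hq1 _ hn2]
    refine exp_div_exp_cpow ?_ (coeff_logSeries_im_natCast hq hq1 _ n) _
    have h := coeff_logSeries_im_natCast hq hq1 (k + 1 - m) (n + 1)
    rwa [show ((n + 1 : ℕ) : ℂ) + 1 = n + 2 by push_cast; ring] at h
  have hset : Icc 1 (k + 1) = Ico (0 + 1) (k + 1 + 1) := by ext; simp
  have h1 := coeff_logSeries_add_one hq hq1 k hn
  have h2 := coeff_logSeries_add_one hq hq1 k hzn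
  rw [show (n : ℂ) + 1 + 1 = n + 2 by ring] at h1
  have h0 : genBinom z 0 = 1 := by simp [genBinom]
  simp only [hprod]
  rw [Function.comp_apply, Nat.add_sub_cancel, qMG_eq_exp hq hq1 k hn, qMG_eq_exp hq hq1 k hzn, ← Complex.exp_sum,
    ← Complex.exp_sub, ← Complex.exp_add, hset, ← sum_Ico_add', ← range_eq_Ico, logRemainder,
    logRemainder, sum_range_succ' _ (k + 1), sum_range_succ' _ (k + 1), h0, Nat.sub_zero]
  simp only [mul_sub, sum_sub_distrib]
  push_cast
  rw [show z + ((n : ℂ) + 1) + 1 = z + n + 1 + 1 by ring, show (n : ℂ) + 1 + 1 = n + 2 by ring,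
    h1, h2]
  congr 1
  ring
end
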